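/- For any two additive codes C₁ and C₂ of type (α,β;γ₁,δ₁;κ₁) and (α,β;γ₂,δ₂;κ₂) respectively, the code ⟨C₁,C₂⟩ is an additive code of type (α,β;γ,δ;κ) for some natural numbers γ, δ, κ satisfying: max(δ₁,δ₂) ≤ δ ≤ min(δ₁+δ₂, β); max(δ, max(κ₁+δ₁, κ₂+δ₂)) ≤ κ+δ ≤ min(κ₁+κ₂+δ₁+δ₂, α+β); and κ+δ ≤ γ+δ ≤ min(γ₁+γ₂+δ₁+δ₂, α+β). -/

import Mathlib

open scoped BigOperators

/-- `Z2` is the ring of integers modulo 2. -/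
abbrev Z2 : Type := ZMod 2

/-- `Z4` is the ring of integers modulo 4. -/
abbrev Z4 : Type := ZMod 4

/-- The ambient group `Z₂^α × Z₄^β` for additive codes. -/
abbrev Amb (α β : ℕ) : Type := (Fin α → Z2) × (Fin β → Z4)

/-- The inner product on `Z₂^α × Z₄^β`:
`⟨u,v⟩ = 2·(Σᵢ ūᵢ·v̄ᵢ) + Σⱼ uⱼ·vⱼ ∈ Z₄`, where the bar denotes the lift `0 ↦ 0`, `1 ↦ 1`
of binary coordinates into `Z₄`. -/
def addInner {α β : ℕ} (u v : Amb α β) : Z4 :=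
  2 * (∑ i, ((u.1 i).val : Z4) * ((v.1 i).val : Z4)) + ∑ j, u.2 j * v.2 j

lemma addInner_zero_left {α β : ℕ} (v : Amb α β) : addInner 0 v = 0 := by
  simp [addInner]

lemma addInner_add_left {α β : ℕ} (u u' v : Amb α β) :
    addInner (u + u') v = addInner u v + addInner u' v := by
  have key : ∀ x x' y : Z2,
      (2 : Z4) * ((((x + x').val : ℕ) : Z4) * ((y.val : ℕ) : Z4)) =
        2 * (((x.val : ℕ) : Z4) * ((y.val : ℕ) : Z4)) +
          2 * (((x'.val : ℕ) : Z4) * ((y.val : ℕ) : Z4)) := by decide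
  simp only [addInner, Prod.fst_add, Prod.snd_add, Pi.add_apply, add_mul,
    Finset.mul_sum, Finset.sum_add_distrib]
  rw [Finset.sum_congr rfl (fun i _ => key (u.1 i) (u'.1 i) (v.1 i)),
    Finset.sum_add_distrib]
  ring

lemma addInner_neg_left {α β : ℕ} (u v : Amb α β) :
    addInner (-u) v = - addInner u v := by
  have hn : ∀ x : Z2, (-x) = x := by decide
  have key : ∀ S T : Z4, 2 * S + -T = -(2 * S + T) := by decide
  simp only [addInner, Prod.fst_neg, Prod.snd_neg, Pi.neg_apply, hn, neg_mul]
  rw [Finset.sum_neg_distrib]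
  exact key _ _

/-- The additive dual `C^⊥ = {u : ⟨u,v⟩ = 0 for all v ∈ C}` of an additive code `C`. -/
def dualCode {α β : ℕ} (C : AddSubgroup (Amb α β)) : AddSubgroup (Amb α β) where
  carrier := {u | ∀ v ∈ C, addInner u v = 0}
  zero_mem' := fun v _ => addInner_zero_left v
  add_mem' := by
    intro a b ha hb v hv
    rw [addInner_add_left, ha v hv, hb v hv, add_zero]
  neg_mem' := by
    intro a ha v hv
    rw [addInner_neg_left, ha v hv, neg_zero]

/-- An additive code `C ⊆ Z₂^α × Z₄^β` is of type `(α,β;γ,δ)` when it is isomorphic,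
as an abelian group, to `Z₂^γ × Z₄^δ`; equivalently (which is how we state it),
`|C| = 2^(γ+2δ)` and the number of elements `x ∈ C` with `x + x = 0` is `2^(γ+δ)`. -/
def isOfType {α β : ℕ} (C : AddSubgroup (Amb α β)) (γ δ : ℕ) : Prop :=
  Nat.card C = 2 ^ (γ + 2 * δ) ∧
    Nat.card {x : Amb α β // x ∈ C ∧ x + x = 0} = 2 ^ (γ + δ)

/-- An additive code `C` is of type `(α,β;γ,δ;κ)` when it is of type `(α,β;γ,δ)` and
`2^κ` is the cardinality of the image of `{x ∈ C : x + x = 0}` under the projection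
onto the binary coordinates. -/
def isOfTypeK {α β : ℕ} (C : AddSubgroup (Amb α β)) (γ δ κ : ℕ) : Prop :=
  isOfType C γ δ ∧
    Nat.card ↥(Prod.fst '' {x : Amb α β | x ∈ C ∧ x + x = 0}) = 2 ^ κ

/-- The Gray map on one quaternary coordinate:
`0 ↦ (0,0)`, `1 ↦ (0,1)`, `2 ↦ (1,1)`, `3 ↦ (1,0)`. -/
def grayPhi (y : Z4) : Z2 × Z2 :=
  if y = 0 then (0, 0) else if y = 1 then (0, 1) else if y = 2 then (1, 1) else (1, 0)

/-- The Gray map `Φ : Z₂^α × Z₄^β → Z₂^(α+2β)` (with index set `Fin α ⊕ Fin β × Fin 2`),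
acting as the identity on the binary coordinates and as `grayPhi` coordinatewise on the
quaternary coordinates. -/
def grayMap {α β : ℕ} (u : Amb α β) : (Fin α ⊕ Fin β × Fin 2) → Z2 :=
  Sum.elim (fun a => u.1 a)
    (fun b => if b.2 = 0 then (grayPhi (u.2 b.1)).1 else (grayPhi (u.2 b.1)).2)

/-- The minimum Hamming distance of a binary code `S` equals `d`. -/
def minDistEq {ι : Type} [Fintype ι] (S : Set (ι → Z2)) (d : ℕ) : Prop :=
  (∀ x ∈ S, ∀ y ∈ S, x ≠ y → d ≤ hammingDist x y) ∧
    ∃ x ∈ S, ∃ y ∈ S, x ≠ y ∧ hammingDist x y = d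

/-- A quaternary linear perfect code of length `β = 2^(t-1)` (`t ≥ 3`): an additive
subgroup of `Z₄^β` whose Gray image has cardinality `2^(2β-t-1)` and minimum Hamming
distance `4`. -/
def isQuatPerfect (t β : ℕ) (C : AddSubgroup (Amb 0 β)) : Prop :=
  3 ≤ t ∧ β = 2 ^ (t - 1) ∧
    Nat.card ↥(grayMap '' (C : Set (Amb 0 β))) = 2 ^ (2 * β - t - 1) ∧
    minDistEq (grayMap '' (C : Set (Amb 0 β))) 4

/-- An additive extended perfect code with `α ≠ 0` and binary length `α + 2β = 2^t`:
an additive subgroup of `Z₂^α × Z₄^β` with `α ≥ 1` whose Gray image has cardinality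
`2^(2^t - t - 1)` and minimum Hamming distance `4`. -/
def isAddExtPerfect (t α β : ℕ) (C : AddSubgroup (Amb α β)) : Prop :=
  1 ≤ α ∧ α + 2 * β = 2 ^ t ∧
    Nat.card ↥(grayMap '' (C : Set (Amb α β))) = 2 ^ (2 ^ t - t - 1) ∧
    minDistEq (grayMap '' (C : Set (Amb α β))) 4

namespace AddSubgroup

variable {G H H' : Type*} [AddCommGroup G] [AddCommGroup H] [AddCommGroup H']

theorem card_inf_mul_relIndex (A B : AddSubgroup G) :
    Nat.card ↥(A ⊓ B) * A.relIndex B = Nat.card B := by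
  rw [← inf_relIndex_right, ← relIndex_bot_left, ← relIndex_bot_left]
  exact relIndex_mul_relIndex _ _ _ bot_le inf_le_right

theorem card_ker_inf_mul_card_map (f : G →+ H) (A : AddSubgroup G) :
    Nat.card ↥(f.ker ⊓ A) * Nat.card (A.map f) = Nat.card A := by
  rw [← relIndex_ker, card_inf_mul_relIndex]

theorem card_sup_mul_card_inf (A B : AddSubgroup G) :
    Nat.card ↥(A ⊔ B) * Nat.card ↥(A ⊓ B) = Nat.card A * Nat.card B := by
  have hsup := card_inf_mul_relIndex A (A ⊔ B)
  have hinf := card_inf_mul_relIndex A B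
  rw [inf_eq_left.mpr le_sup_left, relIndex_sup_left] at hsup
  rw [← hsup, ← hinf]
  ring

theorem card_mono [Finite G] {A B : AddSubgroup G} (h : A ≤ B) : Nat.card A ≤ Nat.card B :=
  Nat.card_mono (Set.toFinite _) h

theorem card_sup_le [Finite G] (A B : AddSubgroup G) :
    Nat.card ↥(A ⊔ B) ≤ Nat.card A * Nat.card B := by
  rw [← card_sup_mul_card_inf]
  exact Nat.le_mul_of_pos_right _ Nat.card_pos

/-- Passing to an image does not increase the index of a subgroup. -/
theorem card_map_mul_card_le [Finite G] (p : G →+ H) {A B : AddSubgroup G} (h : A ≤ B) :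
    Nat.card (B.map p) * Nat.card A ≤ Nat.card (A.map p) * Nat.card B := by
  rw [← card_ker_inf_mul_card_map p A, ← card_ker_inf_mul_card_map p B]
  calc _ = Nat.card (A.map p) * (Nat.card ↥(p.ker ⊓ A) * Nat.card (B.map p)) := by ring
    _ ≤ _ := Nat.mul_le_mul_left _
      (Nat.mul_le_mul_right _ (card_mono (inf_le_inf_left _ h)))

theorem card_ker_inf_sup_le [Finite G] (f : G →+ G) {A B : AddSubgroup G}
    (hA : A.map f ≤ A) (hB : B.map f ≤ B) :
    Nat.card ↥(f.ker ⊓ (A ⊔ B)) ≤ Nat.card ↥(f.ker ⊓ A) * Nat.card ↥(f.ker ⊓ B) := by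
  have hD := card_ker_inf_mul_card_map f (A ⊔ B)
  have hsup := card_sup_mul_card_inf A B
  have hmap := card_sup_mul_card_inf (A.map f) (B.map f)
  rw [← map_sup] at hmap
  rw [← card_ker_inf_mul_card_map f A, ← card_ker_inf_mul_card_map f B, ← hD] at hsup
  have hle : Nat.card ↥(A.map f ⊓ B.map f) ≤ Nat.card ↥(A ⊓ B) := card_mono (inf_le_inf hA hB)
  have hpos : 0 < Nat.card ((A ⊔ B).map f) * Nat.card ↥(A ⊓ B) :=
    Nat.mul_pos Nat.card_pos Nat.card_pos
  refine Nat.le_of_mul_le_mul_right ?_ hpos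
  calc _ = Nat.card ↥(f.ker ⊓ A) * Nat.card ↥(f.ker ⊓ B) *
          (Nat.card (A.map f) * Nat.card (B.map f)) := by rw [← mul_assoc, hsup]; ring
    _ ≤ _ := by
      rw [← hmap]
      exact Nat.mul_le_mul_left _ (Nat.mul_le_mul_left _ hle)

theorem card_map_ker_inf_sup_mul_le [Finite G] [Finite H] (f : G →+ H') (p : G →+ H)
    (A B : AddSubgroup G) :
    Nat.card ((f.ker ⊓ (A ⊔ B)).map p) * Nat.card ((A ⊔ B).map f) ≤
      Nat.card ((f.ker ⊓ A).map p) * Nat.card ((f.ker ⊓ B).map p) *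
        (Nat.card (A.map f) * Nat.card (B.map f)) := by
  have hD := card_ker_inf_mul_card_map f (A ⊔ B)
  have hsup := card_sup_mul_card_inf A B
  rw [← card_ker_inf_mul_card_map f A, ← card_ker_inf_mul_card_map f B, ← hD] at hsup
  have hker := card_sup_mul_card_inf (f.ker ⊓ A) (f.ker ⊓ B)
  have hle : Nat.card ↥((f.ker ⊓ A) ⊓ (f.ker ⊓ B)) ≤ Nat.card ↥(A ⊓ B) :=
    card_mono (inf_le_inf inf_le_right inf_le_right)
  have hind := card_map_mul_card_le p
    (sup_le (inf_le_inf_left f.ker (le_sup_left : A ≤ A ⊔ B))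
      (inf_le_inf_left f.ker (le_sup_right : B ≤ A ⊔ B)))
  have hk := card_sup_le ((f.ker ⊓ A).map p) ((f.ker ⊓ B).map p)
  rw [← map_sup] at hk
  have hpos : 0 < Nat.card ↥(f.ker ⊓ A ⊔ f.ker ⊓ B) * Nat.card ↥(A ⊓ B) :=
    Nat.mul_pos Nat.card_pos Nat.card_pos
  refine Nat.le_of_mul_le_mul_right ?_ hpos
  generalize Nat.card ((f.ker ⊓ (A ⊔ B)).map p) = k at *
  generalize Nat.card ((f.ker ⊓ A ⊔ f.ker ⊓ B).map p) = k' at *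
  generalize Nat.card ((f.ker ⊓ A).map p) * Nat.card ((f.ker ⊓ B).map p) = k₁₂ at *
  generalize Nat.card ↥(f.ker ⊓ A ⊔ f.ker ⊓ B) = u at *
  generalize Nat.card ((A ⊔ B).map f) = d at *
  generalize Nat.card ↥(f.ker ⊓ (A ⊔ B)) = t at *
  generalize Nat.card (A.map f) = d₁ at *
  generalize Nat.card (B.map f) = d₂ at *
  calc k * d * (u * Nat.card ↥(A ⊓ B)) = (k * u) * (d * Nat.card ↥(A ⊓ B)) := by ring
    _ ≤ (k₁₂ * t) * (d * Nat.card ↥(A ⊓ B)) :=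
        Nat.mul_le_mul_right _ (hind.trans (Nat.mul_le_mul_right _ hk))
    _ = k₁₂ * (t * d * Nat.card ↥(A ⊓ B)) := by ring
    _ = k₁₂ * (d₁ * d₂) * (u * Nat.card ↥((f.ker ⊓ A) ⊓ (f.ker ⊓ B))) := by
        rw [hsup, hker]; ring
    _ ≤ _ := Nat.mul_le_mul_left _ (Nat.mul_le_mul_left _ hle)

end AddSubgroup

section AdditiveCode

variable {α β : ℕ}

/-- The doubling endomorphism of the ambient group. -/
def doubling (α β : ℕ) : Amb α β →+ Amb α β := nsmulAddMonoidHom 2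

theorem doubling_apply (x : Amb α β) : doubling α β x = x + x := two_nsmul x

theorem fst_doubling (x : Amb α β) : (doubling α β x).1 = 0 := by
  funext i
  rw [doubling_apply]
  exact CharTwo.add_self_eq_zero (x.1 i)

theorem doubling_doubling (x : Amb α β) : doubling α β (doubling α β x) = 0 := by
  have h : ∀ y : Z4, y + y + (y + y) = 0 := by decide
  refine Prod.ext (fst_doubling _) ?_
  funext j
  simp only [doubling_apply]
  exact h (x.2 j)

theorem map_doubling_le_ker (C : AddSubgroup (Amb α β)) :
    C.map (doubling α β) ≤ (doubling α β).ker := by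
  rintro _ ⟨x, -, rfl⟩
  exact doubling_doubling x

theorem map_doubling_le (C : AddSubgroup (Amb α β)) : C.map (doubling α β) ≤ C := by
  rintro _ ⟨x, hx, rfl⟩
  rw [doubling_apply]
  exact C.add_mem hx hx

theorem map_doubling_le_ker_fst_inf (C : AddSubgroup (Amb α β)) :
    C.map (doubling α β) ≤
      (AddMonoidHom.fst (Fin α → Z2) (Fin β → Z4)).ker ⊓ ((doubling α β).ker ⊓ C) := by
  refine le_inf ?_ (le_inf (map_doubling_le_ker C) (map_doubling_le C))
  rintro _ ⟨x, -, rfl⟩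
  exact fst_doubling x

theorem eq_of_add_self_eq_zero_of_indicator_eq {u v : Fin β → Z4} (hu : u + u = 0)
    (hv : v + v = 0)
    (h : (fun j => if u j = 0 then (0 : Z2) else 1) = fun j => if v j = 0 then 0 else 1) :
    u = v := by
  have h4 : ∀ a b : Z4, a + a = 0 → b + b = 0 →
      (if a = 0 then (0 : Z2) else 1) = (if b = 0 then 0 else 1) → a = b := by decide
  funext j
  exact h4 _ _ (congrFun hu j) (congrFun hv j) (congrFun h j)

theorem card_ker_doubling_le : Nat.card (doubling α β).ker ≤ 2 ^ (α + β) := by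
  let g : (doubling α β).ker → (Fin α → Z2) × (Fin β → Z2) :=
    fun x => (x.1.1, fun j => if x.1.2 j = 0 then 0 else 1)
  have hg : Function.Injective g := by
    rintro ⟨x, hx⟩ ⟨y, hy⟩ h
    rw [AddMonoidHom.mem_ker, doubling_apply] at hx hy
    obtain ⟨hfst, hsnd⟩ := Prod.ext_iff.mp h
    exact Subtype.ext (Prod.ext hfst (eq_of_add_self_eq_zero_of_indicator_eq
      (congrArg Prod.snd hx) (congrArg Prod.snd hy) hsnd))
  refine (Nat.card_le_card_of_injective g hg).trans_eq ?_
  simp [pow_add]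

theorem card_map_doubling_le (C : AddSubgroup (Amb α β)) :
    Nat.card (C.map (doubling α β)) ≤ 2 ^ β := by
  let g : C.map (doubling α β) → (Fin β → Z2) := fun x j => if x.1.2 j = 0 then 0 else 1
  have hg : Function.Injective g := by
    rintro ⟨_, x, hx, rfl⟩ ⟨_, y, hy, rfl⟩ h
    have h2 (z : Amb α β) : (doubling α β z).2 + (doubling α β z).2 = 0 :=
      congrArg Prod.snd ((doubling_apply _).symm.trans (doubling_doubling z))
    exact Subtype.ext (Prod.ext ((fst_doubling x).trans (fst_doubling y).symm)
      (eq_of_add_self_eq_zero_of_indicator_eq (h2 x) (h2 y) h))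
  refine (Nat.card_le_card_of_injective g hg).trans_eq ?_
  simp

theorem mem_ker_doubling_inf {C : AddSubgroup (Amb α β)} {x : Amb α β} :
    x ∈ (doubling α β).ker ⊓ C ↔ x ∈ C ∧ x + x = 0 := by
  rw [AddSubgroup.mem_inf, AddMonoidHom.mem_ker, doubling_apply, and_comm]

theorem card_torsion_eq (C : AddSubgroup (Amb α β)) :
    Nat.card {x : Amb α β // x ∈ C ∧ x + x = 0} = Nat.card ↥((doubling α β).ker ⊓ C) :=
  Nat.card_congr (Equiv.subtypeEquivRight fun _ => mem_ker_doubling_inf.symm)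

theorem card_fst_torsion_eq (C : AddSubgroup (Amb α β)) :
    Nat.card ↥(Prod.fst '' {x : Amb α β | x ∈ C ∧ x + x = 0}) =
      Nat.card (((doubling α β).ker ⊓ C).map (AddMonoidHom.fst (Fin α → Z2) (Fin β → Z4))) := by
  have h : {x : Amb α β | x ∈ C ∧ x + x = 0} = ((doubling α β).ker ⊓ C : AddSubgroup _) :=
    Set.ext fun _ => mem_ker_doubling_inf.symm
  rw [h]
  rfl

/-- A code has type `(α,β;γ,δ;κ)` exactly when its double, its 2-torsion and the binary
projection of its 2-torsion have `2 ^ δ`, `2 ^ (γ + δ)` and `2 ^ κ` elements. -/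
theorem isOfTypeK_iff (C : AddSubgroup (Amb α β)) (γ δ κ : ℕ) :
    isOfTypeK C γ δ κ ↔ Nat.card (C.map (doubling α β)) = 2 ^ δ ∧
      Nat.card ↥((doubling α β).ker ⊓ C) = 2 ^ (γ + δ) ∧
      Nat.card (((doubling α β).ker ⊓ C).map (AddMonoidHom.fst (Fin α → Z2) (Fin β → Z4))) =
        2 ^ κ := by
  have hexp : γ + 2 * δ = γ + δ + δ := by ring
  rw [isOfTypeK, isOfType, card_torsion_eq, card_fst_torsion_eq,
    ← AddSubgroup.card_ker_inf_mul_card_map (doubling α β) C, hexp, pow_add 2 (γ + δ) δ]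
  constructor
  · rintro ⟨⟨hC, hT⟩, hk⟩
    rw [hT] at hC
    exact ⟨Nat.eq_of_mul_eq_mul_left (by positivity) hC, hT, hk⟩
  · rintro ⟨hd, hT, hk⟩
    exact ⟨⟨by rw [hd, hT], hT⟩, hk⟩

theorem exists_card_eq_two_pow (C : AddSubgroup (Amb α β)) : ∃ n, Nat.card C = 2 ^ n := by
  have h : Nat.card (Amb α β) = 2 ^ (α + 2 * β) := by
    simp [pow_add, pow_mul]
  obtain ⟨n, -, hn⟩ := (Nat.dvd_prime_pow Nat.prime_two).mp (h ▸ C.card_addSubgroup_dvd_card)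
  exact ⟨n, hn⟩

theorem exists_card_eq_two_pow_of_binary (S : AddSubgroup (Fin α → Z2)) :
    ∃ n ≤ α, Nat.card S = 2 ^ n := by
  have h : Nat.card (Fin α → Z2) = 2 ^ α := by simp
  exact (Nat.dvd_prime_pow Nat.prime_two).mp (h ▸ S.card_addSubgroup_dvd_card)

end AdditiveCode

/-- bounds on the type (with `κ`) of the span of two additive codes. -/
theorem stmt2 {α β γ₁ δ₁ κ₁ γ₂ δ₂ κ₂ : ℕ} (C₁ C₂ : AddSubgroup (Amb α β))
    (h₁ : isOfTypeK C₁ γ₁ δ₁ κ₁) (h₂ : isOfTypeK C₂ γ₂ δ₂ κ₂) :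
    ∃ γ δ κ : ℕ, isOfTypeK (C₁ ⊔ C₂) γ δ κ ∧
      max δ₁ δ₂ ≤ δ ∧ δ ≤ min (δ₁ + δ₂) β ∧
      max δ (max (κ₁ + δ₁) (κ₂ + δ₂)) ≤ κ + δ ∧
      κ + δ ≤ min (κ₁ + κ₂ + δ₁ + δ₂) (α + β) ∧
      κ + δ ≤ γ + δ ∧ γ + δ ≤ min (γ₁ + γ₂ + δ₁ + δ₂) (α + β) := by
  rw [isOfTypeK_iff] at h₁ h₂
  obtain ⟨hd₁, ht₁, hk₁⟩ := h₁
  obtain ⟨hd₂, ht₂, hk₂⟩ := h₂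
  obtain ⟨δ, hd⟩ := exists_card_eq_two_pow ((C₁ ⊔ C₂).map (doubling α β))
  obtain ⟨τ, ht⟩ := exists_card_eq_two_pow ((doubling α β).ker ⊓ (C₁ ⊔ C₂))
  obtain ⟨κ, hκα, hk⟩ := exists_card_eq_two_pow_of_binary
    (((doubling α β).ker ⊓ (C₁ ⊔ C₂)).map (AddMonoidHom.fst (Fin α → Z2) (Fin β → Z4)))
  have two_pow_le {m n : ℕ} (h : 2 ^ m ≤ 2 ^ n) : m ≤ n :=
    (Nat.pow_le_pow_iff_right Nat.one_lt_two).mp h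
  have hl : C₁ ≤ C₁ ⊔ C₂ := le_sup_left
  have hr : C₂ ≤ C₁ ⊔ C₂ := le_sup_right
  have hδ₁ : δ₁ ≤ δ := two_pow_le (hd₁ ▸ hd ▸ AddSubgroup.card_mono (AddSubgroup.map_mono hl))
  have hδ₂ : δ₂ ≤ δ := two_pow_le (hd₂ ▸ hd ▸ AddSubgroup.card_mono (AddSubgroup.map_mono hr))
  have hδ : δ ≤ δ₁ + δ₂ := two_pow_le <| by
    rw [pow_add, ← hd, ← hd₁, ← hd₂, AddSubgroup.map_sup]
    exact AddSubgroup.card_sup_le _ _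
  have hδβ : δ ≤ β := two_pow_le (hd ▸ card_map_doubling_le _)
  have hκ₁ : κ₁ ≤ κ := two_pow_le (hk₁ ▸ hk ▸ AddSubgroup.card_mono
    (AddSubgroup.map_mono (inf_le_inf_left _ hl)))
  have hκ₂ : κ₂ ≤ κ := two_pow_le (hk₂ ▸ hk ▸ AddSubgroup.card_mono
    (AddSubgroup.map_mono (inf_le_inf_left _ hr)))
  have hκδ : κ + δ ≤ κ₁ + κ₂ + (δ₁ + δ₂) := two_pow_le <| by
    simp only [pow_add, ← hk, ← hd, ← hk₁, ← hk₂, ← hd₁, ← hd₂]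
    exact AddSubgroup.card_map_ker_inf_sup_mul_le _ _ _ _
  have hκτ : δ + κ ≤ τ := two_pow_le <| by
    rw [pow_add, ← hk, ← hd, ← ht, ← AddSubgroup.card_ker_inf_mul_card_map
      (AddMonoidHom.fst (Fin α → Z2) (Fin β → Z4)) ((doubling α β).ker ⊓ (C₁ ⊔ C₂))]
    exact Nat.mul_le_mul_right _ (AddSubgroup.card_mono (map_doubling_le_ker_fst_inf _))
  have hτ : τ ≤ γ₁ + δ₁ + (γ₂ + δ₂) := two_pow_le <| by
    rw [pow_add 2 (γ₁ + δ₁), ← ht, ← ht₁, ← ht₂]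
    exact AddSubgroup.card_ker_inf_sup_le _ (map_doubling_le _) (map_doubling_le _)
  have hταβ : τ ≤ α + β :=
    two_pow_le (ht ▸ (AddSubgroup.card_mono inf_le_left).trans card_ker_doubling_le)
  obtain ⟨γ, rfl⟩ : ∃ γ, τ = γ + δ := ⟨τ - δ, by omega⟩
  refine ⟨γ, δ, κ, (isOfTypeK_iff _ _ _ _).mpr ⟨hd, ht, hk⟩, ?_⟩
  omega
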